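/- Let Λ > 0 and a ∈ ℝ. Fix (t₀, r₀, θ₀, φ₀) with θ₀ ∈ (0, π) and Λr₀²/3 > 1, and set Δ_θ = 1 + (Λ/3)a² cos²θ₀, Δ₀ = 1 + (Λ/3)a², ρ² = r₀² + a² cos²θ₀, Δ_r⁰ = (r₀² + a²)(1 − Λr₀²/3). Define new coordinates by t = t₀, φ = φ₀ − (Λ/3) a t₀, r = √( (r₀² Δ_θ + a² sin²θ₀)/Δ₀ ), and θ = arccos( r₀ cos θ₀ / r ). Then r > 0, |r₀ cosθ₀ / r| < 1, Λr²/3 > 1, and for every v = (T, R, Θ, Φ) ∈ ℝ⁴ (representing the coordinate differentials (dt₀, dr₀, dθ₀, dφ₀)): −(Λr²/3 − 1)^(−1)(Dr[v])² + (Λr²/3 − 1)(Dt[v])² + r²( (Dθ[v])² + sin²θ (Dφ[v])² ) = ((Λ/3)(r₀² + a² sin²θ₀) − 1)T² + (ρ²/Δ_r⁰)R² + (ρ²/Δ_θ)Θ² − (2Λ/3) a ((r₀²+a²)/Δ₀) sin²θ₀ · TΦ + ((r₀²+a²)/Δ₀) sin²θ₀ · Φ², where Dt, Dr, Dθ, Dφ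 are the Fréchet derivatives at (t₀, r₀, θ₀, φ₀) of the functions t, r, θ, φ applied to v. -/

import Mathlib

open Real

/-- The time coordinate `t = t₀` as a function of `(t₀, r₀, θ₀, φ₀)`. -/
noncomputable def tKdS : ℝ × ℝ × ℝ × ℝ → ℝ := fun p => p.1

/-- The radial coordinate `r = √((r₀²Δ_θ + a²sin²θ₀)/Δ₀)` adapted to a Kerr–de Sitter
black hole with rotation parameter `a`. -/
noncomputable def rKdS (Λ a : ℝ) : ℝ × ℝ × ℝ × ℝ → ℝ := fun p =>
  Real.sqrt ((p.2.1 ^ 2 * (1 + Λ / 3 * a ^ 2 * cos p.2.2.1 ^ 2) +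
    a ^ 2 * sin p.2.2.1 ^ 2) / (1 + Λ / 3 * a ^ 2))

/-- The polar coordinate `θ = arccos(r₀ cos θ₀ / r)`. -/
noncomputable def θKdS (Λ a : ℝ) : ℝ × ℝ × ℝ × ℝ → ℝ := fun p =>
  Real.arccos (p.2.1 * cos p.2.2.1 / rKdS Λ a p)

/-- The azimuthal coordinate `φ = φ₀ - (Λ/3)a t₀`. -/
noncomputable def φKdS (Λ a : ℝ) : ℝ × ℝ × ℝ × ℝ → ℝ := fun p =>
  p.2.2.2 - Λ / 3 * a * p.1

/-- The squared radial coordinate `r²`, as a function of `(t₀, r₀, θ₀, φ₀)`. -/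
noncomputable def radiusSq (Λ a : ℝ) (p : ℝ × ℝ × ℝ × ℝ) : ℝ :=
  (p.2.1 ^ 2 * (1 + Λ / 3 * a ^ 2 * cos p.2.2.1 ^ 2) +
    a ^ 2 * sin p.2.2.1 ^ 2) / (1 + Λ / 3 * a ^ 2)

lemma rKdS_eq_sqrt_radiusSq (Λ a : ℝ) : rKdS Λ a = fun p => √(radiusSq Λ a p) := rfl

lemma hasFDerivAt_radius_coord (p : ℝ × ℝ × ℝ × ℝ) :
    HasFDerivAt (fun q : ℝ × ℝ × ℝ × ℝ => q.2.1)
      ((ContinuousLinearMap.fst ℝ ℝ (ℝ × ℝ)).comp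
        (ContinuousLinearMap.snd ℝ ℝ (ℝ × ℝ × ℝ))) p :=
  ((ContinuousLinearMap.fst ℝ ℝ (ℝ × ℝ)).comp
    (ContinuousLinearMap.snd ℝ ℝ (ℝ × ℝ × ℝ))).hasFDerivAt

lemma hasFDerivAt_polar_coord (p : ℝ × ℝ × ℝ × ℝ) :
    HasFDerivAt (fun q : ℝ × ℝ × ℝ × ℝ => q.2.2.1)
      ((ContinuousLinearMap.fst ℝ ℝ ℝ).comp ((ContinuousLinearMap.snd ℝ ℝ (ℝ × ℝ)).comp
        (ContinuousLinearMap.snd ℝ ℝ (ℝ × ℝ × ℝ)))) p :=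
  ((ContinuousLinearMap.fst ℝ ℝ ℝ).comp ((ContinuousLinearMap.snd ℝ ℝ (ℝ × ℝ)).comp
    (ContinuousLinearMap.snd ℝ ℝ (ℝ × ℝ × ℝ)))).hasFDerivAt

lemma exists_hasFDerivAt_radiusSq (Λ a : ℝ) (p : ℝ × ℝ × ℝ × ℝ) :
    ∃ L : ℝ × ℝ × ℝ × ℝ →L[ℝ] ℝ, HasFDerivAt (radiusSq Λ a) L p ∧
      ∀ v, L v = 2 * (p.2.1 * (1 + Λ / 3 * a ^ 2 * cos p.2.2.1 ^ 2) * v.2.1 +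
        a ^ 2 * sin p.2.2.1 * cos p.2.2.1 * (1 - Λ * p.2.1 ^ 2 / 3) * v.2.2.1) /
          (1 + Λ / 3 * a ^ 2) := by
  have hr := hasFDerivAt_radius_coord p
  have hθ := hasFDerivAt_polar_coord p
  refine ⟨_, (((hr.pow 2).mul (((hθ.cos.pow 2).const_mul (Λ / 3 * a ^ 2)).const_add 1)).add
    ((hθ.sin.pow 2).const_mul (a ^ 2))).mul_const (1 + Λ / 3 * a ^ 2)⁻¹, fun v => ?_⟩
  simp
  ring

lemma exists_hasFDerivAt_axial (p : ℝ × ℝ × ℝ × ℝ) :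
    ∃ L : ℝ × ℝ × ℝ × ℝ →L[ℝ] ℝ,
      HasFDerivAt (fun q : ℝ × ℝ × ℝ × ℝ => q.2.1 * cos q.2.2.1) L p ∧
      ∀ v, L v = cos p.2.2.1 * v.2.1 - p.2.1 * sin p.2.2.1 * v.2.2.1 := by
  refine ⟨_, (hasFDerivAt_radius_coord p).mul (hasFDerivAt_polar_coord p).cos, fun v => ?_⟩
  simp
  ring

lemma fderiv_tKdS (p v : ℝ × ℝ × ℝ × ℝ) : fderiv ℝ tKdS p v = v.1 := by
  have h : HasFDerivAt tKdS (ContinuousLinearMap.fst ℝ ℝ (ℝ × ℝ × ℝ)) p :=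
    (ContinuousLinearMap.fst ℝ ℝ (ℝ × ℝ × ℝ)).hasFDerivAt
  simp [h.fderiv]

lemma fderiv_φKdS (Λ a : ℝ) (p v : ℝ × ℝ × ℝ × ℝ) :
    fderiv ℝ (φKdS Λ a) p v = v.2.2.2 - Λ / 3 * a * v.1 := by
  have h : HasFDerivAt (φKdS Λ a) ((ContinuousLinearMap.snd ℝ ℝ ℝ).comp
      ((ContinuousLinearMap.snd ℝ ℝ (ℝ × ℝ)).comp (ContinuousLinearMap.snd ℝ ℝ (ℝ × ℝ × ℝ))) -
      (Λ / 3 * a) • ContinuousLinearMap.fst ℝ ℝ (ℝ × ℝ × ℝ)) p :=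
    ((ContinuousLinearMap.snd ℝ ℝ ℝ).comp ((ContinuousLinearMap.snd ℝ ℝ (ℝ × ℝ)).comp
      (ContinuousLinearMap.snd ℝ ℝ (ℝ × ℝ × ℝ)))).hasFDerivAt.sub
        ((ContinuousLinearMap.fst ℝ ℝ (ℝ × ℝ × ℝ)).hasFDerivAt.const_mul (Λ / 3 * a))
  simp [h.fderiv]

/-- If `z = r cos θ`, then `(r dθ)² sin² θ = (dz - cos θ dr)²`, here with `dr = d(r²) / (2r)`. -/
lemma sq_fderiv_arccos_div_sqrt {E : Type*} [NormedAddCommGroup E] [NormedSpace ℝ E]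
    {S z : E → ℝ} {S' z' : E →L[ℝ] ℝ} {p : E} (hS : HasFDerivAt S S' p)
    (hz : HasFDerivAt z z' p) (hpos : 0 < S p) (hlt : z p ^ 2 < S p) (v : E) :
    (fderiv ℝ (fun q => arccos (z q / √(S q))) p v) ^ 2 =
      (S p * z' v - z p * S' v / 2) ^ 2 / (S p ^ 2 * (S p - z p ^ 2)) := by
  have hr : 0 < √(S p) := sqrt_pos.2 hpos
  have hsq : √(S p) ^ 2 = S p := sq_sqrt hpos.le
  have hu : (z p / √(S p)) ^ 2 < 1 := by
    rw [div_pow, hsq, div_lt_one hpos]; exact hlt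
  have habs := abs_lt.1 ((sq_lt_one_iff_abs_lt_one _).1 hu)
  have h := (hasDerivAt_arccos habs.1.ne' habs.2.ne).comp_hasFDerivAt p
    (hz.mul ((hasDerivAt_inv hr.ne').comp_hasFDerivAt p (hS.sqrt hpos.ne')))
  have h' : fderiv ℝ (fun q => arccos (z q / √(S q))) p = _ := h.fderiv
  simp only [Function.comp_apply] at h'
  have hW : 0 < S p - z p ^ 2 := sub_pos.2 hlt
  have hone : 1 - (z p / √(S p)) ^ 2 = (S p - z p ^ 2) / S p := by
    rw [div_pow, hsq]; field_simp
  rw [h']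
  simp only [smul_apply, add_apply, smul_eq_mul]
  rw [mul_pow, neg_sq, div_pow, one_pow, sq_sqrt (sub_nonneg.2 hu.le), hone]
  generalize √(S p) = r at *
  generalize S p = s at *
  subst hsq
  field_simp
  ring

/-- Pulling back the static de Sitter metric
`-(Λr²/3-1)⁻¹dr² + (Λr²/3-1)dt² + r²(dθ² + sin²θ dφ²)` under the coordinate change
`(t₀,r₀,θ₀,φ₀) ↦ (t,r,θ,φ)` adapted to a Kerr–de Sitter black hole of specific angular
momentum `a` yields the stated Boyer–Lindquist-type form of the de Sitter metric. -/
theorem stmt_16 (Λ a : ℝ) (hΛ : 0 < Λ) (t₀ r₀ θ₀ φ₀ : ℝ)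
    (hθ₀ : θ₀ ∈ Set.Ioo (0 : ℝ) π) (hr₀ : Λ * r₀ ^ 2 / 3 > 1)
    (Δθ Δ0 ρ2 ΔrZ : ℝ)
    (hΔθ : Δθ = 1 + Λ / 3 * a ^ 2 * cos θ₀ ^ 2)
    (hΔ0 : Δ0 = 1 + Λ / 3 * a ^ 2)
    (hρ2 : ρ2 = r₀ ^ 2 + a ^ 2 * cos θ₀ ^ 2)
    (hΔrZ : ΔrZ = (r₀ ^ 2 + a ^ 2) * (1 - Λ * r₀ ^ 2 / 3)) :
    0 < rKdS Λ a (t₀, r₀, θ₀, φ₀) ∧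
    |r₀ * cos θ₀ / rKdS Λ a (t₀, r₀, θ₀, φ₀)| < 1 ∧
    Λ * rKdS Λ a (t₀, r₀, θ₀, φ₀) ^ 2 / 3 > 1 ∧
    ∀ v : ℝ × ℝ × ℝ × ℝ,
      -(Λ * rKdS Λ a (t₀, r₀, θ₀, φ₀) ^ 2 / 3 - 1)⁻¹ *
          (fderiv ℝ (rKdS Λ a) (t₀, r₀, θ₀, φ₀) v) ^ 2 +
        (Λ * rKdS Λ a (t₀, r₀, θ₀, φ₀) ^ 2 / 3 - 1) *
          (fderiv ℝ tKdS (t₀, r₀, θ₀, φ₀) v) ^ 2 +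
        rKdS Λ a (t₀, r₀, θ₀, φ₀) ^ 2 *
          ((fderiv ℝ (θKdS Λ a) (t₀, r₀, θ₀, φ₀) v) ^ 2 +
            sin (θKdS Λ a (t₀, r₀, θ₀, φ₀)) ^ 2 *
              (fderiv ℝ (φKdS Λ a) (t₀, r₀, θ₀, φ₀) v) ^ 2) =
      (Λ / 3 * (r₀ ^ 2 + a ^ 2 * sin θ₀ ^ 2) - 1) * v.1 ^ 2 +
        ρ2 / ΔrZ * v.2.1 ^ 2 + ρ2 / Δθ * v.2.2.1 ^ 2 -
        2 * Λ / 3 * a * ((r₀ ^ 2 + a ^ 2) / Δ0) * sin θ₀ ^ 2 * (v.1 * v.2.2.2) +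
        (r₀ ^ 2 + a ^ 2) / Δ0 * sin θ₀ ^ 2 * v.2.2.2 ^ 2 := by
  obtain ⟨hθpos, hθlt⟩ := hθ₀
  have hs : 0 < sin θ₀ := sin_pos_of_pos_of_lt_pi hθpos hθlt
  have hcs : sin θ₀ ^ 2 = 1 - cos θ₀ ^ 2 := sin_sq θ₀
  have hD0 : 0 < Δ0 := by rw [hΔ0]; positivity
  have hDθ : 0 < Δθ := by rw [hΔθ]; positivity
  have hm : 0 < Λ * r₀ ^ 2 / 3 - 1 := by linarith
  have hr₀sq : 0 < r₀ ^ 2 := by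
    rcases (sq_nonneg r₀).eq_or_lt with h | h
    · rw [← h] at hr₀; norm_num at hr₀
    · exact h
  have hA : 0 < r₀ ^ 2 + a ^ 2 := by positivity
  set p : ℝ × ℝ × ℝ × ℝ := (t₀, r₀, θ₀, φ₀) with hp
  have hS : radiusSq Λ a p = (r₀ ^ 2 * Δθ + a ^ 2 * sin θ₀ ^ 2) / Δ0 := by
    rw [hΔθ, hΔ0]; rfl
  have hQ : 0 < r₀ ^ 2 * Δθ + a ^ 2 * sin θ₀ ^ 2 := by positivity
  have hSpos : 0 < radiusSq Λ a p := by rw [hS]; positivity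
  have hW : radiusSq Λ a p - (r₀ * cos θ₀) ^ 2 = (r₀ ^ 2 + a ^ 2) / Δ0 * sin θ₀ ^ 2 := by
    rw [hS]; field_simp; rw [hΔθ, hΔ0, hcs]; ring
  have hWpos : 0 < radiusSq Λ a p - (r₀ * cos θ₀) ^ 2 := by rw [hW]; positivity
  have hK : Λ * radiusSq Λ a p / 3 - 1 = Δθ * (Λ * r₀ ^ 2 / 3 - 1) / Δ0 := by
    rw [hS]; field_simp; rw [hΔθ, hΔ0, hcs]; ring
  have hKpos : 0 < Λ * radiusSq Λ a p / 3 - 1 := by rw [hK]; positivity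
  have hrpos : 0 < rKdS Λ a p := sqrt_pos.2 hSpos
  have hrsq : rKdS Λ a p ^ 2 = radiusSq Λ a p := sq_sqrt hSpos.le
  have hu : (r₀ * cos θ₀ / rKdS Λ a p) ^ 2 < 1 := by
    rw [div_pow, hrsq, div_lt_one hSpos]; linarith
  refine ⟨hrpos, (sq_lt_one_iff_abs_lt_one _).1 hu, by rw [hrsq]; linarith, fun v => ?_⟩
  obtain ⟨S', hS', hS'v⟩ := exists_hasFDerivAt_radiusSq Λ a p
  obtain ⟨z', hz', hz'v⟩ := exists_hasFDerivAt_axial p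
  have hdr : (fderiv ℝ (rKdS Λ a) p v) ^ 2 = S' v ^ 2 / (4 * radiusSq Λ a p) := by
    rw [rKdS_eq_sqrt_radiusSq, (hS'.sqrt hSpos.ne').fderiv, smul_apply,
      smul_eq_mul, mul_pow, div_pow, mul_pow, sq_sqrt hSpos.le]
    ring
  have hdθ : (fderiv ℝ (θKdS Λ a) p v) ^ 2 =
      (radiusSq Λ a p * z' v - r₀ * cos θ₀ * S' v / 2) ^ 2 /
        (radiusSq Λ a p ^ 2 * (radiusSq Λ a p - (r₀ * cos θ₀) ^ 2)) :=
    sq_fderiv_arccos_div_sqrt hS' hz' hSpos (sub_pos.1 hWpos) v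
  have hsin : radiusSq Λ a p * sin (θKdS Λ a p) ^ 2 =
      (r₀ ^ 2 + a ^ 2) / Δ0 * sin θ₀ ^ 2 := by
    have : θKdS Λ a p = arccos (r₀ * cos θ₀ / rKdS Λ a p) := rfl
    rw [this, sin_arccos, sq_sqrt (sub_nonneg.2 hu.le), div_pow, hrsq, ← hW]
    field_simp
  have hS'P : S' v = 2 * (r₀ * Δθ * v.2.1 -
      a ^ 2 * sin θ₀ * cos θ₀ * (Λ * r₀ ^ 2 / 3 - 1) * v.2.2.1) / Δ0 := by
    rw [hS'v, hΔθ, hΔ0]; simp only [hp]; ring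
  have hN : radiusSq Λ a p * z' v - r₀ * cos θ₀ * S' v / 2 =
      sin θ₀ * (a ^ 2 * sin θ₀ * cos θ₀ * v.2.1 - r₀ * (r₀ ^ 2 + a ^ 2) * v.2.2.1) / Δ0 := by
    rw [hS'P, hz'v, hS]; simp only [hp]; field_simp
    rw [hΔθ]; linear_combination (-3 * (r₀ * a ^ 2 * sin θ₀ * v.2.2.1)) * hcs
  have hspatial : -(Λ * radiusSq Λ a p / 3 - 1)⁻¹ * (fderiv ℝ (rKdS Λ a) p v) ^ 2 +
      radiusSq Λ a p * (fderiv ℝ (θKdS Λ a) p v) ^ 2 =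
      ρ2 / ΔrZ * v.2.1 ^ 2 + ρ2 / Δθ * v.2.2.1 ^ 2 := by
    have hΔr : ΔrZ = -((r₀ ^ 2 + a ^ 2) * (Λ * r₀ ^ 2 / 3 - 1)) := by rw [hΔrZ]; ring
    have hρQ : ρ2 = (r₀ ^ 2 * Δθ * (r₀ ^ 2 + a ^ 2) -
        (Λ * r₀ ^ 2 / 3 - 1) * a ^ 4 * sin θ₀ ^ 2 * cos θ₀ ^ 2) /
          (r₀ ^ 2 * Δθ + a ^ 2 * sin θ₀ ^ 2) := by
      rw [eq_div_iff hQ.ne', hρ2, hΔθ, hcs]; ring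
    rw [hdr, hdθ, hN, hS'P, hW, hK, hS, hΔr, hρQ]
    generalize Λ * r₀ ^ 2 / 3 - 1 = m at hm ⊢
    field_simp
    ring
  have htime : Λ * radiusSq Λ a p / 3 - 1 +
      (r₀ ^ 2 + a ^ 2) / Δ0 * sin θ₀ ^ 2 * (Λ / 3 * a) ^ 2 =
      Λ / 3 * (r₀ ^ 2 + a ^ 2 * sin θ₀ ^ 2) - 1 := by
    rw [hK]; field_simp; rw [hΔθ, hΔ0, hcs]; ring
  rw [hrsq, fderiv_tKdS, fderiv_φKdS]
  linear_combination hspatial + v.1 ^ 2 * htime +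
    (v.2.2.2 - Λ / 3 * a * v.1) ^ 2 * hsin
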